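/- Let a, b be natural numbers and let φ : ℤ^a → ℤ^b be a ℤ-linear map. Let α ≥ 1 be a real number such that ‖φ(e_i)‖ ≤ α for every standard basis vector e_i of ℤ^a, where ‖·‖ denotes the Euclidean norm on ℤ^b ⊆ ℝ^b. Then the torsion subgroup of the cokernel Q = ℤ^b / im(φ) is finite of cardinality at most α^{min(a,b)}. -/

import Mathlib

/-- **Hadamard's inequality** for real matrices. -/
theorem Matrix.abs_det_le_prod_sqrt {n : ℕ} (A : Matrix (Fin n) (Fin n) ℝ) :
    |A.det| ≤ ∏ i, Real.sqrt (∑ j, A i j ^ 2) := by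
  have : Fact (Module.finrank ℝ (EuclideanSpace ℝ (Fin n)) = n) := ⟨finrank_euclideanSpace_fin⟩
  let e := EuclideanSpace.basisFun (Fin n) ℝ
  let v : Fin n → EuclideanSpace ℝ (Fin n) := fun i => WithLp.toLp 2 (A i)
  have h := e.toBasis.orientation.abs_volumeForm_apply_le v
  rw [e.toBasis.orientation.volumeForm_robust' e v, Module.Basis.det_apply] at h
  have hA : e.toBasis.toMatrix v = A.transpose := by
    ext i j
    simp [e, v, Module.Basis.toMatrix_apply]
  simpa [hA, v, EuclideanSpace.norm_eq] using h

/-- The coordinatewise inclusion `ℤ^b → ℝ^b`. -/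
def intCastVec (b : ℕ) : (Fin b → ℤ) →ₗ[ℤ] (Fin b → ℝ) :=
  (Int.castAddHom ℝ).toIntLinearMap.compLeft (Fin b)

@[simp]
theorem intCastVec_apply {b : ℕ} (x : Fin b → ℤ) (j : Fin b) : intCastVec b x j = x j := rfl

/-- A full-rank sublattice of `ℤ^b` has finite index, bounded by the product of the
lengths of any basis. -/
theorem finite_quotient_span_and_card_le {b : ℕ} {w : Fin b → Fin b → ℤ}
    (hw : LinearIndependent ℝ (intCastVec b ∘ w)) :
    Finite ((Fin b → ℤ) ⧸ Submodule.span ℤ (Set.range w)) ∧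
      (Nat.card ((Fin b → ℤ) ⧸ Submodule.span ℤ (Set.range w)) : ℝ)
        ≤ ∏ i, Real.sqrt (∑ j, (w i j : ℝ) ^ 2) := by
  have hwZ : LinearIndependent ℤ w :=
    (hw.restrict_scalars (R := ℤ)
      (by simpa using (Int.cast_injective : Function.Injective ((↑) : ℤ → ℝ)))).of_comp _
  have hcard := Submodule.natAbs_det_basis_change (Pi.basisFun ℤ (Fin b)) _
    (Module.Basis.span hwZ)
  have hcoe : ((↑) : Submodule.span ℤ (Set.range w) → Fin b → ℤ) ∘ Module.Basis.span hwZ = w := by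
    ext1 i
    exact congrArg Subtype.val (Module.Basis.span_apply hwZ i)
  have hdet : (Pi.basisFun ℤ (Fin b)).det w = (Matrix.of w).det := by
    rw [Pi.basisFun_det_apply]
  rw [hcoe, hdet] at hcard
  let A : Matrix (Fin b) (Fin b) ℝ := (Matrix.of w).map (Int.cast : ℤ → ℝ)
  have hA : A.det = ((Matrix.of w).det : ℝ) := (Int.cast_det _).symm
  have hA0 : IsUnit A.det := by
    rw [← Matrix.isUnit_iff_isUnit_det, ← Matrix.linearIndependent_rows_iff_isUnit]
    exact hw
  constructor
  · apply Nat.finite_of_card_ne_zero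
    rw [← hcard, Int.natAbs_ne_zero]
    intro h0
    simp [hA, h0] at hA0
  · rw [← hcard, Nat.cast_natAbs, Int.cast_abs, ← hA]
    exact A.abs_det_le_prod_sqrt

/-- If a finite-index subgroup `L` meets the saturation of `M` only inside `M`, then the torsion of
`V / M` has at most as many elements as the index of `L`. -/
theorem finite_torsion_and_card_le {V : Type*} [AddCommGroup V] (M L : Submodule ℤ V)
    [Finite (V ⧸ L)] (h : ∀ x ∈ L, ∀ k : ℤ, k ≠ 0 → k • x ∈ M → x ∈ M) :
    Finite (Submodule.torsion ℤ (V ⧸ M)) ∧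
      Nat.card (Submodule.torsion ℤ (V ⧸ M)) ≤ Nat.card (V ⧸ L) := by
  let f : Submodule.torsion ℤ (V ⧸ M) → V ⧸ L := fun t => L.mkQ (Quotient.out t.1)
  have hf : Function.Injective f := by
    intro s t hst
    have hL : Quotient.out s.1 - Quotient.out t.1 ∈ L := (Submodule.Quotient.eq L).1 hst
    obtain ⟨k, hk⟩ := (Submodule.mem_torsion_iff _).1 (s - t).2
    have hs : Submodule.Quotient.mk (p := M) (Quotient.out s.1) = s.1 := Quotient.out_eq _
    have ht : Submodule.Quotient.mk (p := M) (Quotient.out t.1) = t.1 := Quotient.out_eq _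
    have hM := h _ hL k (nonZeroDivisors.ne_zero k.2) (by
      rw [← Submodule.Quotient.mk_eq_zero, Submodule.Quotient.mk_smul, Submodule.Quotient.mk_sub,
        hs, ht]
      exact hk)
    rw [← Submodule.Quotient.eq, hs, ht] at hM
    exact Subtype.ext hM
  exact ⟨Finite.of_injective f hf, Nat.card_le_card_of_injective f hf⟩

/-- Let `w` be linearly independent over `ℝ`. If part of `w` lies in `M` and spans `M` over `ℝ`,
then the lattice spanned by `w` meets the saturation of `M` only inside `M`. -/
theorem mem_of_smul_mem_of_mem_span {b : ℕ} {w : Fin b → Fin b → ℤ}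
    (hw : LinearIndependent ℝ (intCastVec b ∘ w)) {M : Submodule ℤ (Fin b → ℤ)} {S : Set (Fin b)}
    (hS : ∀ i ∈ S, w i ∈ M)
    (hM : ∀ x ∈ M, intCastVec b x ∈ Submodule.span ℝ ((intCastVec b ∘ w) '' S))
    {x : Fin b → ℤ} (hx : x ∈ Submodule.span ℤ (Set.range w)) {k : ℤ} (hk : k ≠ 0)
    (hkx : k • x ∈ M) : x ∈ M := by
  obtain ⟨c, rfl⟩ := (Submodule.mem_span_range_iff_exists_fun ℤ).1 hx
  have hmem : intCastVec b (∑ i, c i • w i) ∈ Submodule.span ℝ ((intCastVec b ∘ w) '' S) := by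
    have h := hM _ hkx
    rw [map_smul, ← Int.cast_smul_eq_zsmul ℝ] at h
    exact (Submodule.smul_mem_iff _ (Int.cast_ne_zero.2 hk)).1 h
  obtain ⟨l, hl, hlc⟩ := (Finsupp.mem_span_image_iff_linearCombination ℝ).1 hmem
  have hcl : l = Finsupp.equivFunOnFinite.symm fun i => (c i : ℝ) := by
    apply hw
    rw [hlc, Finsupp.linearCombination_apply, Finsupp.sum_fintype _ _ (by simp)]
    simp only [map_sum, map_smul, Finsupp.equivFunOnFinite_symm_apply_apply, Function.comp_apply,
      Int.cast_smul_eq_zsmul]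
  refine Submodule.sum_mem _ fun i _ => ?_
  by_cases hi : i ∈ S
  · exact M.smul_mem _ (hS i hi)
  · have : l i = 0 := by
      by_contra h
      exact hi (hl (Finsupp.mem_support_iff.2 h))
    rw [hcl, Finsupp.equivFunOnFinite_symm_apply_apply, Int.cast_eq_zero] at this
    simp [this]

/-- The images of a basis can be thinned out to a spanning independent family and completed by
standard basis vectors to a basis of `ℝ^b`. -/
theorem exists_linearIndependent_sumElim {a b : ℕ} (φ : (Fin a → ℤ) →ₗ[ℤ] (Fin b → ℤ)) :
    ∃ p : Fin b → Fin a ⊕ Fin b, Function.Injective p ∧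
      LinearIndependent ℝ (intCastVec b ∘
        Sum.elim (fun i => φ (Pi.single i 1)) (fun j => Pi.single j 1) ∘ p) ∧
      ∀ x ∈ LinearMap.range φ, intCastVec b x ∈ Submodule.span ℝ ((intCastVec b ∘
        Sum.elim (fun i => φ (Pi.single i 1)) (fun j => Pi.single j 1) ∘ p) ''
          {i | (p i).isLeft}) := by
  set g : Fin a ⊕ Fin b → Fin b → ℤ :=
    Sum.elim (fun i => φ (Pi.single i 1)) (fun j => Pi.single j 1)
  let v := intCastVec b ∘ g
  obtain ⟨u, hu, -, huspan, huli⟩ := exists_linearIndepOn_extension (K := ℝ) (v := v)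
    (linearIndepOn_empty ℝ v) (Set.empty_subset (Set.range Sum.inl))
  obtain ⟨t, -, hut, htspan, htli⟩ := exists_linearIndepOn_extension huli (Set.subset_univ u)
  have htop : Submodule.span ℝ (Set.range fun i : t => v i) = ⊤ := by
    rw [eq_top_iff, ← (Pi.basisFun ℝ (Fin b)).span_eq, Submodule.span_le]
    rintro _ ⟨j, rfl⟩
    have h := htspan ⟨Sum.inr j, trivial, rfl⟩
    rw [Set.image_eq_range] at h
    convert! h using 1
    ext k
    simp [v, g, Pi.single_apply, apply_ite]
  let B : Module.Basis t ℝ (Fin b → ℝ) := Module.Basis.mk htli htop.ge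
  let e : Fin b ≃ t := (Pi.basisFun ℝ (Fin b)).indexEquiv B
  refine ⟨fun i => (e i : Fin a ⊕ Fin b), Subtype.val_injective.comp e.injective,
    htli.comp e e.injective, ?_⟩
  rintro _ ⟨y, rfl⟩
  have hy : intCastVec b (φ y) = ∑ i, (y i : ℝ) • v (Sum.inl i) := by
    conv_lhs => rw [LinearMap.pi_apply_eq_sum_univ φ y]
    simp only [map_sum, map_smul, Int.cast_smul_eq_zsmul]
    refine Finset.sum_congr rfl fun i _ => ?_
    congr 3
    ext j
    simp [Pi.single_apply, eq_comm]
  rw [hy]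
  refine Submodule.sum_mem _ fun i _ => Submodule.smul_mem _ _ ?_
  refine Submodule.span_mono ?_ (huspan ⟨_, ⟨i, rfl⟩, rfl⟩)
  rintro _ ⟨z, hz, rfl⟩
  obtain ⟨k, rfl⟩ := hu hz
  exact ⟨e.symm ⟨_, hut hz⟩, by simp, by simp [v]⟩

/-- **Gabber's lemma.** If `φ : ℤ^a → ℤ^b` is a `ℤ`-linear map such that every image
of a standard basis vector has Euclidean norm at most `α` (with `α ≥ 1`), then the
torsion subgroup of the cokernel `ℤ^b / im φ` is finite of cardinality at most
`α ^ min a b`. -/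
theorem gabber_lemma (a b : ℕ) (φ : (Fin a → ℤ) →ₗ[ℤ] (Fin b → ℤ)) (α : ℝ) (hα : 1 ≤ α)
    (hφ : ∀ i : Fin a,
      Real.sqrt (∑ j : Fin b, ((φ (Pi.single i 1)) j : ℝ) ^ 2) ≤ α) :
    Finite (Submodule.torsion ℤ ((Fin b → ℤ) ⧸ LinearMap.range φ)) ∧
      (Nat.card (Submodule.torsion ℤ ((Fin b → ℤ) ⧸ LinearMap.range φ)) : ℝ)
        ≤ α ^ min a b := by
  obtain ⟨p, hp, hli, hspan⟩ := exists_linearIndependent_sumElim φ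
  set g : Fin a ⊕ Fin b → Fin b → ℤ :=
    Sum.elim (fun i => φ (Pi.single i 1)) (fun j => Pi.single j 1)
  obtain ⟨hfin, hcard⟩ := finite_quotient_span_and_card_le hli
  have hmem : ∀ i ∈ {i | (p i).isLeft}, (g ∘ p) i ∈ LinearMap.range φ := by
    intro i hi
    obtain ⟨k, hk⟩ := Sum.isLeft_iff.1 hi
    exact ⟨Pi.single k 1, by simp [g, hk]⟩
  obtain ⟨hT, hTcard⟩ := finite_torsion_and_card_le (LinearMap.range φ) _
    fun x hx k hk hkx => mem_of_smul_mem_of_mem_span hli hmem hspan hx hk hkx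
  refine ⟨hT, (Nat.cast_le.2 hTcard).trans (hcard.trans ?_)⟩
  have hle : ∀ i, Real.sqrt (∑ j, ((g ∘ p) i j : ℝ) ^ 2) ≤ if (p i).isLeft then α else 1 := by
    intro i
    rcases h : p i with k | k
    · simpa [g, h] using hφ k
    · simp [g, h, Pi.single_apply, apply_ite]
  have hleft : (Finset.univ.filter fun i => (p i).isLeft).card ≤ a := by
    calc _ ≤ (Finset.univ.map (Function.Embedding.inl : Fin a ↪ Fin a ⊕ Fin b)).card := by
          refine Finset.card_le_card_of_injOn p (fun i hi => ?_) hp.injOn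
          obtain ⟨k, hk⟩ := Sum.isLeft_iff.1 (Finset.mem_filter.1 hi).2
          simp [hk]
      _ = a := by simp
  calc _ ≤ ∏ i, if (p i).isLeft then α else 1 :=
        Finset.prod_le_prod (fun i _ => Real.sqrt_nonneg _) fun i _ => hle i
    _ = α ^ (Finset.univ.filter fun i => (p i).isLeft).card := by
        rw [Finset.prod_ite]
        simp
    _ ≤ α ^ min a b :=
        pow_le_pow_right₀ hα (le_min hleft ((Finset.card_filter_le _ _).trans (by simp)))
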